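/- Let N > 2, let Ω ⊂ ℝ^N be a bounded connected open set with C² boundary, and let f satisfy hypotheses (H0)' and (H1). Then for every constant C₀ > 0 there exists a constant C > 0 such that every classical solution u of -Δu = f(x,u) in Ω with u = 0 on ∂Ω and ‖u‖_{2*} ≤ C₀ satisfies ‖u‖_∞ ≤ C. In particular, any sequence of solutions uniformly bounded in the L^{2*}(Ω)-norm is uniformly bounded in the L^∞(Ω)-norm. -/

import Mathlib

open MeasureTheory Filter Set

noncomputable section

/-- The Laplacian of `u : ℝ^N → ℝ` at `x`: the trace of the second Fréchet derivative,
computed along the standard orthonormal basis of `EuclideanSpace ℝ (Fin N)`. -/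
def lap {N : ℕ} (u : EuclideanSpace ℝ (Fin N) → ℝ) (x : EuclideanSpace ℝ (Fin N)) : ℝ :=
  ∑ i : Fin N, iteratedFDeriv ℝ 2 u x ![EuclideanSpace.single i 1, EuclideanSpace.single i 1]

/-- A classical solution of the Dirichlet problem `-Δu = f(x,u)` in `Ω`, `u = 0` on `∂Ω`:
`u` is continuous on the closure of `Ω`, twice continuously differentiable in `Ω`,
satisfies the equation pointwise in `Ω` and vanishes on the boundary. -/
def IsClassicalSolution {N : ℕ} (Ω : Set (EuclideanSpace ℝ (Fin N)))
    (f : EuclideanSpace ℝ (Fin N) → ℝ → ℝ) (u : EuclideanSpace ℝ (Fin N) → ℝ) : Prop :=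
  ContinuousOn u (closure Ω) ∧ ContDiffOn ℝ 2 u Ω ∧
    (∀ x ∈ Ω, -lap u x = f x (u x)) ∧ ∀ x ∈ frontier Ω, u x = 0

/-- `‖u‖_∞ := sup_{x ∈ closure Ω} |u x|`. -/
def supNorm {N : ℕ} (Ω : Set (EuclideanSpace ℝ (Fin N)))
    (u : EuclideanSpace ℝ (Fin N) → ℝ) : ℝ :=
  sSup ((fun x => |u x|) '' closure Ω)

/-- `‖u‖_p := (∫_Ω |u|^p)^{1/p}`. -/
def lpNorm {N : ℕ} (Ω : Set (EuclideanSpace ℝ (Fin N))) (p : ℝ)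
    (u : EuclideanSpace ℝ (Fin N) → ℝ) : ℝ :=
  (∫ x in Ω, |u x| ^ p) ^ (1 / p)

/-- The critical Sobolev exponent `2* = 2N/(N-2)`. -/
def twoStar (N : ℕ) : ℝ := 2 * N / ((N : ℝ) - 2)

/-- `2*_{N/r} := 2*(1 - 1/r)`. -/
def twoStarSub (N : ℕ) (r : ℝ) : ℝ := twoStar N * (1 - 1 / r)

/-- The critical Sobolev-Hardy exponent `2*_μ := 2(N-μ)/(N-2)`. -/
def twoStarMu (N : ℕ) (μ : ℝ) : ℝ := 2 * ((N : ℝ) - μ) / ((N : ℝ) - 2)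

/-- The exponent `A`: `A = 1` if `r ≤ N`, `A = 1 + 2/N - 2/r` if `r > N`. -/
def expA (N : ℕ) (r : ℝ) : ℝ := if r ≤ N then 1 else 1 + 2 / N - 2 / r

/-- The exponent `B`: `B = 1 + 2(1-μ)/N` if `μ ∈ (0,1)`, `B = 1` if `μ ∈ [1,2)`. -/
def expB (N : ℕ) (μ : ℝ) : ℝ := if μ < 1 then 1 + 2 * (1 - μ) / N else 1

/-- The subcriticality gauge `h(s) := s^{p-1} / max (f̃(-s)) (f̃(s))`. -/
def hGauge (p : ℝ) (ftil : ℝ → ℝ) (s : ℝ) : ℝ := s ^ (p - 1) / max (ftil (-s)) (ftil s)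


lemma cutoff_exists (k η : ℝ) (hη : 0 < η) : ∃ φ φ' : ℝ → ℝ, (∀ s, HasDerivAt φ (φ' s) s) ∧
    Continuous φ' ∧ (∀ s, 0 ≤ φ' s) ∧ (∀ s, φ' s ≤ 1) ∧ (∀ s, s ≤ k → φ s = 0) ∧
    (∀ s, 0 ≤ φ s) ∧ (∀ s, k ≤ s → φ s ≤ s - k) ∧ (∀ s, s - k - η ≤ φ s) := by
  set g : ℝ → ℝ := fun t => min 1 (max 0 ((t - k) / η)) with hg
  have hgc : Continuous g := by fun_prop
  have g0 : ∀ s, 0 ≤ g s := fun s => le_min zero_le_one (le_max_left _ _)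
  have g1 : ∀ s, g s ≤ 1 := fun s => min_le_left _ _
  have hgi : ∀ a b, IntervalIntegrable g volume a b := fun a b => hgc.intervalIntegrable a b
  have hz : ∀ s, s ≤ k → ∫ t in k..s, g t = 0 := by
    intro s hs
    rw [intervalIntegral.integral_symm, neg_eq_zero]
    have : ∫ t in s..k, g t = ∫ t in s..k, (0:ℝ) := by
      apply intervalIntegral.integral_congr
      intro t ht
      rw [uIcc_of_le hs] at ht
      have : (t - k) / η ≤ 0 := div_nonpos_of_nonpos_of_nonneg (by linarith [ht.2]) hη.le
      simp [hg, max_eq_left this]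
    simpa using this
  have hnn : ∀ s, 0 ≤ ∫ t in k..s, g t := by
    intro s
    rcases le_total s k with h | h
    · rw [hz s h]
    · exact intervalIntegral.integral_nonneg h (fun t _ => g0 t)
  refine ⟨fun s => ∫ t in k..s, g t, g, ?_, hgc, g0, g1, hz, hnn, ?_, ?_⟩
  · intro s
    exact intervalIntegral.integral_hasDerivAt_right (hgi _ _)
      (hgc.stronglyMeasurableAtFilter _ _) hgc.continuousAt
  · intro s hs
    have := intervalIntegral.integral_mono_on hs (hgi k s) (intervalIntegrable_const (c := (1:ℝ)))
      (fun t _ => g1 t)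
    simpa using this
  · intro s
    rcases le_total s (k + η) with h | h
    · have := hnn s
      simp only
      linarith
    · have e : ∫ t in k..s, g t = (∫ t in k..(k+η), g t) + ∫ t in (k+η)..s, g t :=
        (intervalIntegral.integral_add_adjacent_intervals (hgi _ _) (hgi _ _)).symm
      have e2 : ∫ t in (k+η)..s, g t = ∫ t in (k+η)..s, (1:ℝ) := by
        apply intervalIntegral.integral_congr
        intro t ht
        rw [uIcc_of_le h] at ht
        have : 1 ≤ (t - k) / η := by rw [le_div_iff₀ hη]; linarith [ht.1]
        simp only [hg]
        rw [min_eq_left]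
        exact this.trans (le_max_right _ _)
      have := hnn (k + η)
      simp only
      rw [e, e2]
      simp
      linarith

lemma twoStar_pos {N : ℕ} (hN : 2 < N) : 0 < twoStar N := by
  have : (2:ℝ) < N := by exact_mod_cast hN
  unfold twoStar
  have h2 : (0:ℝ) < (N:ℝ) - 2 := by linarith
  positivity

lemma sobolev_exists {N : ℕ} (hN : 2 < N) : ∃ S : ℝ, 0 < S ∧
    ∀ w : EuclideanSpace ℝ (Fin N) → ℝ, ContDiff ℝ 1 w → HasCompactSupport w →
      ((∫ x, |w x| ^ (twoStar N)) ^ (1 / twoStar N)) ^ 2 ≤ S * ∫ x, ‖fderiv ℝ w x‖ ^ 2 := by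
  have hq := twoStar_pos hN
  have hN' : (2:ℝ) < N := by exact_mod_cast hN
  set q : NNReal := ⟨twoStar N, hq.le⟩ with hqdef
  set c := eLpNormLESNormFDerivOfEqInnerConst
    (volume : Measure (EuclideanSpace ℝ (Fin N))) (2:NNReal) with hc
  refine ⟨(c:ℝ)^2 + 1, by positivity, fun w hw hws => ?_⟩
  have h := eLpNorm_le_eLpNorm_fderiv_of_eq_inner (volume : Measure (EuclideanSpace ℝ (Fin N)))
    hw hws (p := 2) (p' := q) (by norm_num)
    (by simp; omega) (by
      change (2 * (N:ℝ) / ((N:ℝ) - 2))⁻¹ = _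
      simp
      have : (N:ℝ) - 2 ≠ 0 := by linarith
      have : (N:ℝ) ≠ 0 := by linarith
      field_simp)
  have hfc : Continuous (fderiv ℝ w) := hw.continuous_fderiv (by norm_num)
  have m1 : MemLp w q volume := hw.continuous.memLp_of_hasCompactSupport hws
  have m2 : MemLp (fderiv ℝ w) (2:NNReal) volume :=
    hfc.memLp_of_hasCompactSupport (hws.fderiv (𝕜 := ℝ))
  have hq0 : (q : ENNReal) ≠ 0 := by
    simp only [ne_eq, ENNReal.coe_eq_zero]
    intro h0
    have : twoStar N = 0 := congrArg NNReal.toReal h0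
    linarith
  rw [m1.eLpNorm_eq_integral_rpow_norm hq0 (by simp),
    m2.eLpNorm_eq_integral_rpow_norm (by simp) (by simp), ← hc] at h
  have e1 : ((c:NNReal):ENNReal) = ENNReal.ofReal (c:ℝ) := by simp
  rw [e1, ← ENNReal.ofReal_mul (by positivity), ENNReal.ofReal_le_ofReal_iff (by positivity)] at h
  have e2 : ((q:NNReal):ENNReal).toReal = twoStar N := rfl
  have e3 : (((2:NNReal):ENNReal)).toReal = 2 := by simp
  rw [e2, e3] at h
  simp only [Real.rpow_two] at h
  have hI : 0 ≤ ∫ x, ‖fderiv ℝ w x‖ ^ 2 := integral_nonneg (fun x => by positivity)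
  have hsq : ((∫ x, ‖fderiv ℝ w x‖ ^ 2) ^ ((2:ℝ)⁻¹)) ^ 2 = ∫ x, ‖fderiv ℝ w x‖ ^ 2 := by
    rw [← Real.rpow_natCast, ← Real.rpow_mul hI]; norm_num
  have hL : 0 ≤ (∫ x, ‖w x‖ ^ (twoStar N)) ^ (twoStar N)⁻¹ :=
    Real.rpow_nonneg (integral_nonneg (fun x => by positivity)) _
  have := pow_le_pow_left₀ hL h 2
  rw [mul_pow, hsq] at this
  simp only [Real.norm_eq_abs] at this
  rw [one_div]
  nlinarith

lemma integrable_mul_compact {N : ℕ} {Ω K : Set (EuclideanSpace ℝ (Fin N))}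
    (hK : IsCompact K) (hKΩ : K ⊆ Ω) {g w : EuclideanSpace ℝ (Fin N) → ℝ}
    (hg : ContinuousOn g Ω) (hw : Continuous w) (h0 : ∀ x, x ∉ K → w x = 0) :
    Integrable (fun x => g x * w x) := by
  rw [← integrableOn_iff_integrable_of_support_subset (s := K)]
  · exact ((hg.mono hKΩ).mul hw.continuousOn).integrableOn_compact hK
  · intro x hx
    by_contra hxK
    exact hx (by simp [h0 x hxK])

/-- norm of a functional on Euclidean space -/
lemma norm_sq_functional {N : ℕ} (L : EuclideanSpace ℝ (Fin N) →L[ℝ] ℝ) :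
    ‖L‖ ^ 2 = ∑ i : Fin N, (L (EuclideanSpace.single i 1)) ^ 2 := by
  set y := (InnerProductSpace.toDual ℝ (EuclideanSpace ℝ (Fin N))).symm L with hy
  have h1 : ‖L‖ = ‖y‖ := by simp [hy]
  have h2 : ∀ x, L x = inner ℝ y x := fun x => by simp [hy]
  rw [h1, EuclideanSpace.norm_sq_eq]
  refine Finset.sum_congr rfl fun i _ => ?_
  rw [h2]
  simp [EuclideanSpace.inner_single_right]

lemma energy_step {N : ℕ} {Ω : Set (EuclideanSpace ℝ (Fin N))} (hΩo : IsOpen Ω)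
    (hΩb : Bornology.IsBounded Ω) {v : EuclideanSpace ℝ (Fin N) → ℝ}
    (hvc : ContinuousOn v (closure Ω)) (hv2 : ContDiffOn ℝ 2 v Ω)
    (hv0 : ∀ x ∈ frontier Ω, v x = 0) {k : ℝ} (hk : 0 < k)
    {φ φ' : ℝ → ℝ} (hφ : ∀ s, HasDerivAt φ (φ' s) s) (hφ'c : Continuous φ')
    (h0 : ∀ s, 0 ≤ φ' s) (h1 : ∀ s, φ' s ≤ 1) (hz : ∀ s, s ≤ k → φ s = 0) :
    ContDiff ℝ 1 (Ω.indicator (fun x => φ (v x))) ∧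
    HasCompactSupport (Ω.indicator (fun x => φ (v x))) ∧
    Integrable (fun x => -lap v x * Ω.indicator (fun x => φ (v x)) x) ∧
    ∫ x, ‖fderiv ℝ (Ω.indicator (fun x => φ (v x))) x‖ ^ 2 ≤
      ∫ x, -lap v x * Ω.indicator (fun x => φ (v x)) x := by
  set w := Ω.indicator (fun x => φ (v x)) with hw
  set K := closure Ω ∩ v ⁻¹' Ici k with hKdef
  have hcl : IsCompact (closure Ω) := hΩb.isCompact_closure
  have hKc : IsCompact K :=
    hcl.of_isClosed_subset (hvc.preimage_isClosed_of_isClosed isClosed_closure isClosed_Ici)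
      inter_subset_left
  have hKΩ : K ⊆ Ω := by
    intro x hx
    by_contra hxΩ
    have : x ∈ frontier Ω := by
      rw [hΩo.frontier_eq]; exact ⟨hx.1, hxΩ⟩
    have h2 := hx.2
    simp only [mem_preimage, mem_Ici, hv0 x this] at h2
    linarith
  have hwK : ∀ x, x ∉ K → w x = 0 := by
    intro x hx
    by_cases hxΩ : x ∈ Ω
    · rw [hw, indicator_of_mem hxΩ]
      apply hz
      by_contra hlt
      exact hx ⟨subset_closure hxΩ, (not_le.mp hlt).le⟩
    · rw [hw, indicator_of_notMem hxΩ]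
  have hφC : ContDiff ℝ 1 φ := by
    rw [contDiff_one_iff_deriv]
    refine ⟨fun s => (hφ s).differentiableAt, ?_⟩
    have : deriv φ = φ' := funext fun s => (hφ s).deriv
    rwa [this]
  have hwΩ : ∀ x ∈ Ω, w =ᶠ[nhds x] fun y => φ (v y) := by
    intro x hx
    filter_upwards [hΩo.mem_nhds hx] with y hy
    rw [hw, indicator_of_mem hy]
  have hvat : ∀ x ∈ Ω, ContDiffAt ℝ 2 v x := fun x hx => hv2.contDiffAt (hΩo.mem_nhds hx)
  have hC1 : ContDiff ℝ 1 w := by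
    rw [contDiff_iff_contDiffAt]
    intro x
    by_cases hx : x ∈ Ω
    · exact (hφC.contDiffAt.comp x ((hvat x hx).of_le (by norm_num))).congr_of_eventuallyEq
        (hwΩ x hx)
    · have : w =ᶠ[nhds x] fun _ => 0 := by
        filter_upwards [hKc.isClosed.isOpen_compl.mem_nhds (fun h => hx (hKΩ h))] with y hy
        exact hwK y hy
      exact contDiffAt_const.congr_of_eventuallyEq this
  have hsupp : HasCompactSupport w := HasCompactSupport.intro hKc hwK
  have htsupp : tsupport w ⊆ K :=
    closure_minimal (fun x hx => by by_contra h; exact hx (hwK x h)) hKc.isClosed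
  have hfw : ∀ x ∈ Ω, fderiv ℝ w x = φ' (v x) • fderiv ℝ v x := by
    intro x hx
    rw [(hwΩ x hx).fderiv_eq]
    have hd := ((hvat x hx).differentiableAt (by norm_num)).hasFDerivAt
    exact ((hφ (v x)).comp_hasFDerivAt x hd).fderiv
  have hfw0 : ∀ x, x ∉ K → fderiv ℝ w x = 0 := by
    intro x hx
    have : w =ᶠ[nhds x] fun _ => 0 := by
      filter_upwards [hKc.isClosed.isOpen_compl.mem_nhds hx] with y hy
      exact hwK y hy
    rw [this.fderiv_eq]; simp
  have hfv : ContDiffOn ℝ 1 (fderiv ℝ v) Ω := hv2.fderiv_of_isOpen hΩo (by norm_num)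
  have hffv : ContinuousOn (fderiv ℝ (fderiv ℝ v)) Ω :=
    (hfv.continuousOn_fderiv_of_isOpen hΩo (by norm_num))
  let e : Fin N → EuclideanSpace ℝ (Fin N) := fun i => EuclideanSpace.single i 1
  have hlap : ∀ x, lap v x = ∑ i, fderiv ℝ (fderiv ℝ v) x (e i) (e i) := by
    intro x
    simp [lap, iteratedFDeriv_two_apply, e]
  have hdd : ∀ i, ∀ x ∈ Ω, HasFDerivAt (fun y => fderiv ℝ v y (e i))
      ((ContinuousLinearMap.apply ℝ ℝ (e i)).comp (fderiv ℝ (fderiv ℝ v) x)) x := by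
    intro i x hx
    have hd : DifferentiableAt ℝ (fderiv ℝ v) x :=
      (hfv.contDiffAt (hΩo.mem_nhds hx)).differentiableAt (by norm_num)
    exact (ContinuousLinearMap.apply ℝ ℝ (e i)).hasFDerivAt.comp x hd.hasFDerivAt
  have hcd : ∀ i, ContinuousOn (fun x => fderiv ℝ v x (e i)) Ω := fun i =>
    hfv.continuousOn.clm_apply continuousOn_const
  have hcdd : ∀ i, ContinuousOn (fun x => fderiv ℝ (fderiv ℝ v) x (e i) (e i)) Ω := fun i =>
    (hffv.clm_apply continuousOn_const).clm_apply continuousOn_const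
  have hcw : ∀ i, Continuous (fun x => fderiv ℝ w x (e i)) := fun i =>
    (hC1.continuous_fderiv (by norm_num)).clm_apply continuous_const
  have I1 : ∀ i, Integrable (fun x => fderiv ℝ (fderiv ℝ v) x (e i) (e i) * w x) := fun i =>
    integrable_mul_compact hKc hKΩ (hcdd i) hC1.continuous hwK
  have I2 : ∀ i, Integrable (fun x => fderiv ℝ v x (e i) * fderiv ℝ w x (e i)) := fun i =>
    integrable_mul_compact hKc hKΩ (hcd i) (hcw i) (fun x hx => by simp [hfw0 x hx])
  have I3 : ∀ i, Integrable (fun x => fderiv ℝ v x (e i) * w x) := fun i =>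
    integrable_mul_compact hKc hKΩ (hcd i) hC1.continuous hwK
  have key : ∀ i, ∫ x, fderiv ℝ v x (e i) * fderiv ℝ w x (e i) =
      - ∫ x, fderiv ℝ (fderiv ℝ v) x (e i) (e i) * w x := by
    intro i
    have heq : ∀ x, fderiv ℝ (fun y => fderiv ℝ v y (e i)) x (e i) * w x =
        fderiv ℝ (fderiv ℝ v) x (e i) (e i) * w x := by
      intro x
      by_cases hx : x ∈ Ω
      · rw [(hdd i x hx).fderiv]; simp
      · simp [hw, indicator_of_notMem hx]
    have := integral_mul_fderiv_eq_neg_fderiv_mul_of_integrable (μ := volume)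
      (f := fun y => fderiv ℝ v y (e i)) (g := w) (v := e i)
      (by simpa only [heq] using I1 i) (I2 i) (I3 i)
      (fun x hx => (hdd i x (hKΩ (htsupp hx))).differentiableAt)
      (fun x _ => hC1.differentiable (by norm_num) x)
    rw [this]
    simp only [heq]
  have hlw : (fun x => -lap v x * w x) =
      fun x => - ∑ i, fderiv ℝ (fderiv ℝ v) x (e i) (e i) * w x := by
    funext x
    rw [hlap, neg_mul, Finset.sum_mul]
  refine ⟨hC1, hsupp, ?_, ?_⟩
  · rw [hlw]
    exact (integrable_finsetSum _ (fun i _ => I1 i)).neg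
  · rw [hlw, integral_neg, integral_finsetSum _ (fun i _ => I1 i), ← Finset.sum_neg_distrib,
      ← Finset.sum_congr rfl (fun i _ => key i), ← integral_finsetSum _ (fun i _ => I2 i)]
    apply integral_mono
    · apply Continuous.integrable_of_hasCompactSupport
      · exact ((hC1.continuous_fderiv (by norm_num)).norm.pow 2)
      · exact (hsupp.fderiv (𝕜 := ℝ)).norm.comp_left (g := fun t : ℝ => t ^ 2) (by norm_num)
    · exact integrable_finsetSum _ (fun i _ => I2 i)
    · intro x
      simp only
      rw [norm_sq_functional]
      apply Finset.sum_le_sum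
      intro i _
      by_cases hx : x ∈ Ω
      · rw [hfw x hx]
        simp only [_root_.smul_apply, smul_eq_mul]
        have a0 := h0 (v x)
        have a1 := h1 (v x)
        change (φ' (v x) * fderiv ℝ v x (e i)) ^ 2 ≤
          fderiv ℝ v x (e i) * (φ' (v x) * fderiv ℝ v x (e i))
        have : φ' (v x) ^ 2 ≤ φ' (v x) := by nlinarith
        nlinarith [mul_le_mul_of_nonneg_right this (sq_nonneg (fderiv ℝ v x (e i)))]
      · rw [hfw0 x (fun h => hx (hKΩ h))]; simp

lemma memLp_rpow_of_compact {N : ℕ} {w : EuclideanSpace ℝ (Fin N) → ℝ} (hc : Continuous w)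
    (hs : HasCompactSupport w) {s : ℝ} (hs0 : 0 < s) (t : ENNReal) :
    MemLp (fun x => w x ^ s) t volume := by
  apply Continuous.memLp_of_hasCompactSupport
  · exact hc.rpow_const (fun x => Or.inr hs0.le)
  · exact hs.comp_left (g := fun t : ℝ => t ^ s) (Real.zero_rpow hs0.ne')

lemma holder_one {N : ℕ} {Ω : Set (EuclideanSpace ℝ (Fin N))}
    {r ρ p q : ℝ} (hrρ : r.HolderConjugate ρ) (hp : 2 < p) (hq : q = p * ρ)
    {a : EuclideanSpace ℝ (Fin N) → ℝ}
    (ha : MemLp (fun x => |a x|) (ENNReal.ofReal r) (volume.restrict Ω))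
    {w : EuclideanSpace ℝ (Fin N) → ℝ} (hc : Continuous w)
    (hs : HasCompactSupport w) (hw0 : ∀ x, 0 ≤ w x) (hwΩ : ∀ x, x ∉ Ω → w x = 0) :
    ∫ x in Ω, |a x| * w x ^ p ≤
      (∫ x in Ω, |a x| ^ r) ^ (1 / r) * ((∫ x, w x ^ q) ^ (1 / q)) ^ p := by
  have hρ : 0 < ρ := hrρ.symm.pos
  have hq0 : 0 < q := by rw [hq]; positivity
  have h := integral_mul_le_Lp_mul_Lq_of_nonneg hrρ (μ := volume.restrict Ω)
    (f := fun x => |a x|) (g := fun x => w x ^ p)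
    (ae_of_all _ fun x => abs_nonneg _) (ae_of_all _ fun x => Real.rpow_nonneg (hw0 x) _) ha
    ((memLp_rpow_of_compact hc hs (by linarith) _).restrict Ω)
  have e : ∫ x in Ω, (w x ^ p) ^ ρ = ∫ x, w x ^ q := by
    rw [setIntegral_eq_integral_of_forall_compl_eq_zero]
    · simp only [hq]
      congr 1; funext x
      rw [Real.rpow_mul (hw0 x)]
    · intro x hx
      rw [hwΩ x hx, Real.zero_rpow (by linarith), Real.zero_rpow hρ.ne']
  rw [e] at h
  have hI : 0 ≤ ∫ x, w x ^ q := integral_nonneg fun x => Real.rpow_nonneg (hw0 x) _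
  have e2 : ((∫ x, w x ^ q) ^ (1 / q)) ^ p = (∫ x, w x ^ q) ^ (1 / ρ) := by
    rw [← Real.rpow_mul hI]; congr 1; rw [hq]; field_simp
  rw [e2]; exact h

lemma holder_two {N : ℕ} {Ω : Set (EuclideanSpace ℝ (Fin N))}
    {r ρ p q : ℝ} (hrρ : r.HolderConjugate ρ) (hp : 2 < p) (hq : q = p * ρ)
    {a : EuclideanSpace ℝ (Fin N) → ℝ}
    (ha : MemLp (fun x => |a x|) (ENNReal.ofReal r) (volume.restrict Ω))
    {w : EuclideanSpace ℝ (Fin N) → ℝ} (hc : Continuous w)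
    (hs : HasCompactSupport w) (hw0 : ∀ x, 0 ≤ w x) (hwΩ : ∀ x, x ∉ Ω → w x = 0)
    {T : Set (EuclideanSpace ℝ (Fin N))} (hT : MeasurableSet T) (hTf : volume T ≠ ⊤)
    (hwT : ∀ x, x ∉ T → w x = 0) :
    ∫ x in Ω, |a x| * w x ≤
      (∫ x in Ω, |a x| ^ r) ^ (1 / r) * ((∫ x, w x ^ q) ^ (1 / q) *
        (volume.real T) ^ ((p - 1) / q)) := by
  have hρ : 0 < ρ := hrρ.symm.pos
  have hq0 : 0 < q := by rw [hq]; positivity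
  have h := integral_mul_le_Lp_mul_Lq_of_nonneg hrρ (μ := volume.restrict Ω)
    (f := fun x => |a x|) (g := fun x => w x)
    (ae_of_all _ fun x => abs_nonneg _) (ae_of_all _ fun x => hw0 x) ha
    ((hc.memLp_of_hasCompactSupport hs).restrict Ω)
  have e : ∫ x in Ω, w x ^ ρ = ∫ x, w x ^ ρ * T.indicator (fun _ => (1:ℝ)) x := by
    rw [setIntegral_eq_integral_of_forall_compl_eq_zero]
    · congr 1; funext x
      by_cases hx : x ∈ T
      · simp [hx]
      · simp [hx, hwT x hx, Real.zero_rpow hρ.ne']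
    · intro x hx
      rw [hwΩ x hx, Real.zero_rpow hρ.ne']
  have hpp : p.HolderConjugate (p / (p - 1)) := Real.HolderConjugate.conjExponent (by linarith)
  have h2 := integral_mul_le_Lp_mul_Lq_of_nonneg hpp (μ := volume)
    (f := fun x => w x ^ ρ) (g := T.indicator (fun _ => (1:ℝ)))
    (ae_of_all _ fun x => Real.rpow_nonneg (hw0 x) _)
    (ae_of_all _ fun x => indicator_nonneg (fun _ _ => zero_le_one) x)
    (memLp_rpow_of_compact hc hs hρ _)
    (memLp_indicator_const _ hT 1 (Or.inr hTf))
  have hpq : 0 < p / (p - 1) := hpp.symm.pos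
  have e3 : ∫ x, (T.indicator (fun _ => (1:ℝ)) x) ^ (p / (p - 1)) = volume.real T := by
    have : (fun x => (T.indicator (fun _ => (1:ℝ)) x) ^ (p / (p - 1))) =
        T.indicator (fun _ => (1:ℝ)) := by
      funext x
      by_cases hx : x ∈ T
      · simp [hx]
      · simp [hx, Real.zero_rpow hpq.ne']
    rw [this, integral_indicator hT]; simp
  have e4 : ∫ x, (w x ^ ρ) ^ p = ∫ x, w x ^ q := by
    congr 1; funext x
    rw [← Real.rpow_mul (hw0 x), hq, mul_comm]
  rw [e3, e4, ← e] at h2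
  have hI : 0 ≤ ∫ x, w x ^ q := integral_nonneg fun x => Real.rpow_nonneg (hw0 x) _
  have hm : 0 ≤ volume.real T := measureReal_nonneg
  have hJ : 0 ≤ ∫ x in Ω, w x ^ ρ := integral_nonneg fun x => Real.rpow_nonneg (hw0 x) _
  have h3 := Real.rpow_le_rpow hJ h2 (z := 1 / ρ) (by positivity)
  rw [Real.mul_rpow (Real.rpow_nonneg hI _) (Real.rpow_nonneg hm _), ← Real.rpow_mul hI,
    ← Real.rpow_mul hm] at h3
  have x1 : 1 / p * (1 / ρ) = 1 / q := by rw [hq]; field_simp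
  have x2 : 1 / (p / (p - 1)) * (1 / ρ) = (p - 1) / q := by
    rw [hq]; have : p - 1 ≠ 0 := by linarith
    field_simp
  rw [x1, x2] at h3
  refine h.trans (mul_le_mul_of_nonneg_left h3 ?_)
  exact Real.rpow_nonneg (integral_nonneg fun x => Real.rpow_nonneg (abs_nonneg _) _) _

lemma rpow_add_le_two {x y s : ℝ} (hx : 0 ≤ x) (hy : 0 ≤ y) (hs : 0 ≤ s) :
    (x + y) ^ s ≤ 2 ^ s * (x ^ s + y ^ s) := by
  have h1 : x + y ≤ 2 * max x y := by linarith [le_max_left x y, le_max_right x y]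
  have h2 : (x + y) ^ s ≤ 2 ^ s * (max x y) ^ s := by
    rw [← Real.mul_rpow (by norm_num) (le_max_of_le_left hx)]
    exact Real.rpow_le_rpow (by positivity) h1 hs
  refine h2.trans (mul_le_mul_of_nonneg_left ?_ (by positivity))
  have := Real.rpow_nonneg hx s
  have := Real.rpow_nonneg hy s
  rcases max_cases x y with ⟨h, _⟩ | ⟨h, _⟩ <;> rw [h] <;> linarith

lemma level_step {N : ℕ} {Ω : Set (EuclideanSpace ℝ (Fin N))} (hΩo : IsOpen Ω)
    (hΩb : Bornology.IsBounded Ω) {v : EuclideanSpace ℝ (Fin N) → ℝ}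
    (hvc : ContinuousOn v (closure Ω)) (hv2 : ContDiffOn ℝ 2 v Ω)
    (hv0 : ∀ x ∈ frontier Ω, v x = 0)
    {r ρ p q : ℝ} (hrρ : r.HolderConjugate ρ) (hp : 2 < p) (hq : q = p * ρ)
    {a : EuclideanSpace ℝ (Fin N) → ℝ}
    (ha : MemLp (fun x => |a x|) (ENNReal.ofReal r) (volume.restrict Ω))
    {S : ℝ} (hS : 0 < S)
    (hSob : ∀ w : EuclideanSpace ℝ (Fin N) → ℝ, ContDiff ℝ 1 w → HasCompactSupport w →
      ((∫ x, |w x| ^ q) ^ (1 / q)) ^ 2 ≤ S * ∫ x, ‖fderiv ℝ w x‖ ^ 2)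
    {K k h ε C₀ : ℝ} (hK : 0 < K) (hKk : K ≤ k) (hkh : k < h) (hh : h ≤ 2 * K) (hε : 0 < ε)
    (hlap : ∀ x ∈ Ω, K ≤ v x → |lap v x| ≤ ε * (|a x| * (v x) ^ (p - 1)))
    (hW : (∫ x in Ω, |v x| ^ q) ^ (1 / q) ≤ C₀)
    (hsmall : S * (ε * 2 ^ (p - 1)) * (∫ x in Ω, |a x| ^ r) ^ (1 / r) * C₀ ^ (p - 2) ≤ 1 / 2) :
    (h - k) / 2 * (volume.real {x | x ∈ Ω ∧ h < v x}) ^ (1 / q) ≤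
      2 * (S * (ε * 2 ^ (p - 1)) * (∫ x in Ω, |a x| ^ r) ^ (1 / r) * (2 * K) ^ (p - 1) *
        (volume.real {x | x ∈ Ω ∧ k < v x}) ^ ((p - 1) / q)) := by
  have hρ : 0 < ρ := hrρ.symm.pos
  have hq0 : 0 < q := by rw [hq]; positivity
  set A := (∫ x in Ω, |a x| ^ r) ^ (1 / r) with hA
  have hA0 : 0 ≤ A :=
    Real.rpow_nonneg (integral_nonneg fun x => Real.rpow_nonneg (abs_nonneg _) _) _
  set η := (h - k) / 2 with hη
  have hη0 : 0 < η := by rw [hη]; linarith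
  have hk0 : 0 < k := by linarith
  obtain ⟨φ, φ', hφ, hφc, hφ0, hφ1, hφz, hφnn, hφu, hφl⟩ := cutoff_exists k η hη0
  obtain ⟨hC1, hsupp, hint, hen⟩ := energy_step hΩo hΩb hvc hv2 hv0 hk0 hφ hφc hφ0 hφ1 hφz
  set w := Ω.indicator (fun x => φ (v x)) with hw
  have hwin : ∀ x ∈ Ω, w x = φ (v x) := fun x hx => by rw [hw, indicator_of_mem hx]
  have hwout : ∀ x, x ∉ Ω → w x = 0 := fun x hx => by rw [hw, indicator_of_notMem hx]
  have hw0 : ∀ x, 0 ≤ w x := fun x => indicator_nonneg (fun _ _ => hφnn _) x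
  have hopen : ∀ t : ℝ, IsOpen {x | x ∈ Ω ∧ t < v x} := fun t =>
    (hv2.continuousOn).isOpen_inter_preimage hΩo isOpen_Ioi
  set T := {x | x ∈ Ω ∧ k < v x} with hTdef
  have hTm : MeasurableSet T := (hopen k).measurableSet
  have hΩfin : volume Ω ≠ ⊤ := hΩb.measure_lt_top.ne
  have hfin : ∀ t : ℝ, volume {x | x ∈ Ω ∧ t < v x} ≠ ⊤ := fun t =>
    (lt_of_le_of_lt (measure_mono fun x hx => hx.1) hΩfin.lt_top).ne
  have hwT : ∀ x, x ∉ T → w x = 0 := by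
    intro x hx
    by_cases hxΩ : x ∈ Ω
    · rw [hwin x hxΩ]; apply hφz; by_contra hc; exact hx ⟨hxΩ, not_le.mp hc⟩
    · exact hwout x hxΩ
  have hH1 := holder_one hrρ hp hq ha hC1.continuous hsupp hw0 hwout
  have hH2 := holder_two hrρ hp hq ha hC1.continuous hsupp hw0 hwout hTm (hfin k) hwT
  have hSw := hSob w hC1 hsupp
  have habs : (fun x => |w x| ^ q) = fun x => w x ^ q := by
    funext x; rw [abs_of_nonneg (hw0 x)]
  rw [habs] at hSw
  have hI : 0 ≤ ∫ x, w x ^ q := integral_nonneg fun x => Real.rpow_nonneg (hw0 x) _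
  set W := (∫ x, w x ^ q) ^ (1 / q) with hWdef
  have hW0 : 0 ≤ W := Real.rpow_nonneg hI _
  have hwq : Integrable (fun x => w x ^ q) :=
    memLp_one_iff_integrable.mp (memLp_rpow_of_compact hC1.continuous hsupp hq0 1)
  set m := volume.real T with hm
  have hm0 : 0 ≤ m := measureReal_nonneg
  rw [← hA] at hH1 hH2
  -- upper bound of W by C₀
  have hWC : W ≤ C₀ := by
    refine le_trans ?_ hW
    refine Real.rpow_le_rpow hI ?_ (by positivity)
    rw [← setIntegral_eq_integral_of_forall_compl_eq_zero (s := Ω)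
      (fun x hx => by rw [hwout x hx, Real.zero_rpow hq0.ne'])]
    have hvi : IntegrableOn (fun x => |v x| ^ q) Ω := by
      have : ContinuousOn (fun x => |v x| ^ q) (closure Ω) :=
        hvc.abs.rpow_const (fun x _ => Or.inr hq0.le)
      exact (this.integrableOn_compact hΩb.isCompact_closure).mono_set subset_closure
    refine setIntegral_mono_on hwq.integrableOn hvi hΩo.measurableSet ?_
    intro x hx
    refine Real.rpow_le_rpow (hw0 x) ?_ hq0.le
    rw [hwin x hx]
    rcases le_total (v x) k with hc | hc
    · rw [hφz _ hc]; positivity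
    · have := hφu _ hc
      linarith [le_abs_self (v x)]
  -- lower bound
  have hlow : η * (volume.real {x | x ∈ Ω ∧ h < v x}) ^ (1 / q) ≤ W := by
    have hM := mul_meas_ge_le_integral_of_nonneg (μ := volume)
      (ae_of_all _ fun x => Real.rpow_nonneg (hw0 x) q) hwq (η ^ q)
    have hsub : {x | x ∈ Ω ∧ h < v x} ⊆ {x | η ^ q ≤ w x ^ q} := by
      intro x hx
      refine Real.rpow_le_rpow hη0.le ?_ hq0.le
      rw [hwin x hx.1]
      have := hφl (v x)
      have := hx.2
      linarith
    have hηq : 0 < η ^ q := Real.rpow_pos_of_pos hη0 q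
    have hfin2 : volume {x | η ^ q ≤ w x ^ q} ≠ ⊤ := by
      refine (lt_of_le_of_lt (measure_mono ?_) hΩfin.lt_top).ne
      intro x hx
      by_contra hxΩ
      simp only [Set.mem_ofPred_eq, hwout x hxΩ, Real.zero_rpow hq0.ne'] at hx
      linarith
    have h1 : η ^ q * volume.real {x | x ∈ Ω ∧ h < v x} ≤ ∫ x, w x ^ q :=
      (mul_le_mul_of_nonneg_left (measureReal_mono hsub hfin2) hηq.le).trans hM
    have h2 := Real.rpow_le_rpow (by positivity) h1 (z := 1 / q) (by positivity)
    rw [Real.mul_rpow hηq.le measureReal_nonneg, ← Real.rpow_mul hη0.le,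
      mul_one_div_cancel hq0.ne', Real.rpow_one] at h2
    exact h2
  refine hlow.trans ?_
  -- integrability
  have hc2 : 0 < ε * 2 ^ (p - 1) := by positivity
  have J1 : IntegrableOn (fun x => |a x| * w x ^ p) Ω := by
    have := hrρ.ennrealOfReal
    exact ha.integrable_mul ((memLp_rpow_of_compact hC1.continuous hsupp
      (by linarith) (ENNReal.ofReal ρ)).restrict Ω)
  have J2 : IntegrableOn (fun x => |a x| * w x) Ω := by
    have := hrρ.ennrealOfReal
    exact ha.integrable_mul ((hC1.continuous.memLp_of_hasCompactSupport hsupp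
      (p := ENNReal.ofReal ρ)).restrict Ω)
  have hmain : ∫ x, -lap v x * w x ≤
      (ε * 2 ^ (p - 1)) * ((∫ x in Ω, |a x| * w x ^ p) +
        (2 * K) ^ (p - 1) * ∫ x in Ω, |a x| * w x) := by
    rw [← setIntegral_eq_integral_of_forall_compl_eq_zero (s := Ω)
      (fun x hx => by rw [hwout x hx, mul_zero]), ← integral_const_mul, ← integral_add J1
      (J2.const_mul _), ← integral_const_mul]
    refine setIntegral_mono_on hint.integrableOn ((J1.add (J2.const_mul _)).const_mul _)
      hΩo.measurableSet ?_
    intro x hx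
    rcases le_or_gt (v x) k with hc | hc
    · have : w x = 0 := by rw [hwin x hx, hφz _ hc]
      rw [this, Real.zero_rpow (by linarith)]; simp
    · have hb := hlap x hx (hKk.trans hc.le)
      have hwx := hw0 x
      have hv : v x ≤ w x + 2 * K := by
        have := hφl (v x)
        rw [hwin x hx]
        linarith
      have hv' : (v x) ^ (p - 1) ≤ 2 ^ (p - 1) * (w x ^ (p - 1) + (2 * K) ^ (p - 1)) :=
        (Real.rpow_le_rpow (by linarith) hv (by linarith)).trans
          (rpow_add_le_two hwx (by linarith) (by linarith))
      have hwp : w x ^ p = w x ^ (p - 1) * w x := by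
        rcases hwx.eq_or_lt with h0 | h0
        · rw [← h0, Real.zero_rpow (by linarith)]; simp
        · rw [← Real.rpow_add_one h0.ne']; simp
      calc -lap v x * w x ≤ |lap v x| * w x :=
            mul_le_mul_of_nonneg_right (neg_le_abs _) hwx
        _ ≤ (ε * (|a x| * (2 ^ (p - 1) * (w x ^ (p - 1) + (2 * K) ^ (p - 1))))) * w x := by
            refine mul_le_mul_of_nonneg_right (hb.trans ?_) hwx
            gcongr
        _ = _ := by rw [hwp]; ring
  set M := m ^ ((p - 1) / q) with hM
  have hM0 : 0 ≤ M := Real.rpow_nonneg hm0 _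
  have hWp : W ^ p ≤ C₀ ^ (p - 2) * W ^ 2 := by
    rcases hW0.eq_or_lt with h0 | h0
    · rw [← h0, Real.zero_rpow (by linarith)]; simp
    · have : W ^ p = W ^ (p - 2) * W ^ 2 := by
        rw [← Real.rpow_two, ← Real.rpow_add h0]; congr 1; ring
      rw [this]
      have := Real.rpow_le_rpow hW0 hWC (z := p - 2) (by linarith)
      gcongr
  have hKp : 0 ≤ (2 * K) ^ (p - 1) := by positivity
  have hfinal : W ^ 2 ≤ W ^ 2 / 2 +
      (S * (ε * 2 ^ (p - 1)) * A * (2 * K) ^ (p - 1) * M) * W := by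
    calc W ^ 2 ≤ S * ∫ x, ‖fderiv ℝ w x‖ ^ 2 := hSw
      _ ≤ S * ((ε * 2 ^ (p - 1)) * (A * (C₀ ^ (p - 2) * W ^ 2) +
          (2 * K) ^ (p - 1) * (A * (W * M)))) := by
          refine mul_le_mul_of_nonneg_left ((hen.trans hmain).trans ?_) hS.le
          refine mul_le_mul_of_nonneg_left ?_ hc2.le
          refine add_le_add (hH1.trans ?_) (mul_le_mul_of_nonneg_left hH2 hKp)
          exact mul_le_mul_of_nonneg_left hWp hA0
      _ = (S * (ε * 2 ^ (p - 1)) * A * C₀ ^ (p - 2)) * W ^ 2 +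
          (S * (ε * 2 ^ (p - 1)) * A * (2 * K) ^ (p - 1) * M) * W := by ring
      _ ≤ _ := by nlinarith [sq_nonneg W]
  rcases hW0.eq_or_lt with h0 | h0
  · rw [← h0]; positivity
  · nlinarith

lemma iteration_decay {z : ℕ → ℝ} {p B C₀ θ : ℝ} (hp : 2 < p) (hC₀ : 0 < C₀) (hB : 0 ≤ B)
    (hz : ∀ j, 0 ≤ z j) (hz0 : z 0 ≤ C₀) (hrec : ∀ j, z (j + 1) ≤ B * 2 ^ j * z j ^ (p - 1))
    (hθ : 0 < θ) (hθp : 2 * θ ^ (p - 2) = 1) (hBθ : B * C₀ ^ (p - 2) ≤ θ) :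
    ∀ j, z j ≤ C₀ * θ ^ j := by
  intro j
  induction j with
  | zero => simpa using hz0
  | succ j ih =>
    have hθj : 0 < θ ^ j := by positivity
    have e1 : (C₀ * θ ^ j) ^ (p - 1) = C₀ ^ (p - 2) * C₀ * ((θ ^ (p - 2)) ^ j * θ ^ j) := by
      have : p - 1 = (p - 2) + 1 := by ring
      rw [this, Real.rpow_add_one (by positivity), Real.mul_rpow hC₀.le hθj.le]
      have : (θ ^ j) ^ (p - 2) = (θ ^ (p - 2)) ^ j := by
        rw [← Real.rpow_natCast, ← Real.rpow_natCast, ← Real.rpow_mul hθ.le,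
          ← Real.rpow_mul hθ.le, mul_comm]
      rw [this]; ring
    calc z (j + 1) ≤ B * 2 ^ j * z j ^ (p - 1) := hrec j
      _ ≤ B * 2 ^ j * (C₀ * θ ^ j) ^ (p - 1) := by
          have := Real.rpow_le_rpow (hz j) ih (z := p - 1) (by linarith)
          gcongr
      _ = (B * C₀ ^ (p - 2)) * (C₀ * θ ^ j) * (2 * θ ^ (p - 2)) ^ j := by
          rw [e1, mul_pow]; ring
      _ ≤ θ * (C₀ * θ ^ j) * (2 * θ ^ (p - 2)) ^ j := by
          rw [hθp]
          gcongr
      _ = C₀ * θ ^ (j + 1) := by rw [hθp]; ring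

lemma one_sided {N : ℕ} {Ω : Set (EuclideanSpace ℝ (Fin N))} (hΩo : IsOpen Ω)
    (hΩb : Bornology.IsBounded Ω) {v : EuclideanSpace ℝ (Fin N) → ℝ}
    (hvc : ContinuousOn v (closure Ω)) (hv2 : ContDiffOn ℝ 2 v Ω)
    (hv0 : ∀ x ∈ frontier Ω, v x = 0)
    {r ρ p q : ℝ} (hrρ : r.HolderConjugate ρ) (hp : 2 < p) (hq : q = p * ρ)
    {a : EuclideanSpace ℝ (Fin N) → ℝ}
    (ha : MemLp (fun x => |a x|) (ENNReal.ofReal r) (volume.restrict Ω))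
    {S : ℝ} (hS : 0 < S)
    (hSob : ∀ w : EuclideanSpace ℝ (Fin N) → ℝ, ContDiff ℝ 1 w → HasCompactSupport w →
      ((∫ x, |w x| ^ q) ^ (1 / q)) ^ 2 ≤ S * ∫ x, ‖fderiv ℝ w x‖ ^ 2)
    {K ε C₀ θ : ℝ} (hK : 0 < K) (hε : 0 < ε) (hC₀ : 0 < C₀)
    (hlap : ∀ x ∈ Ω, K ≤ v x → |lap v x| ≤ ε * (|a x| * (v x) ^ (p - 1)))
    (hW : (∫ x in Ω, |v x| ^ q) ^ (1 / q) ≤ C₀)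
    (hθ : 0 < θ) (hθ1 : θ < 1) (hθp : 2 * θ ^ (p - 2) = 1)
    (hsmall : S * (ε * 2 ^ (p - 1)) * (∫ x in Ω, |a x| ^ r) ^ (1 / r) * C₀ ^ (p - 2) *
      (8 * 2 ^ (p - 1)) ≤ θ) :
    ∀ x ∈ closure Ω, v x ≤ 2 * K := by
  have hρ : 0 < ρ := hrρ.symm.pos
  have hq0 : 0 < q := by rw [hq]; positivity
  set A := (∫ x in Ω, |a x| ^ r) ^ (1 / r) with hA
  have hA0 : 0 ≤ A :=
    Real.rpow_nonneg (integral_nonneg fun x => Real.rpow_nonneg (abs_nonneg _) _) _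
  have h2p : (1:ℝ) ≤ 2 ^ (p - 1) := Real.one_le_rpow (by norm_num) (by linarith)
  have hsm : S * (ε * 2 ^ (p - 1)) * A * C₀ ^ (p - 2) ≤ 1 / 2 := by
    have : 0 ≤ S * (ε * 2 ^ (p - 1)) * A * C₀ ^ (p - 2) := by positivity
    nlinarith
  have hopen : ∀ t : ℝ, IsOpen {x | x ∈ Ω ∧ t < v x} := fun t =>
    (hv2.continuousOn).isOpen_inter_preimage hΩo isOpen_Ioi
  have hΩfin : volume Ω ≠ ⊤ := hΩb.measure_lt_top.ne
  have hfin : ∀ t : ℝ, volume {x | x ∈ Ω ∧ t < v x} ≠ ⊤ := fun t =>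
    (lt_of_le_of_lt (measure_mono fun x hx => hx.1) hΩfin.lt_top).ne
  set κ : ℕ → ℝ := fun j => K * (2 - (1/2) ^ j) with hκ
  set z : ℕ → ℝ := fun j => K * (volume.real {x | x ∈ Ω ∧ κ j < v x}) ^ (1 / q) with hz
  have hz0 : ∀ j, 0 ≤ z j := fun j => mul_nonneg hK.le (Real.rpow_nonneg measureReal_nonneg _)
  have hstart : z 0 ≤ C₀ := by
    refine le_trans ?_ hW
    have hvi : IntegrableOn (fun x => |v x| ^ q) Ω := by
      have : ContinuousOn (fun x => |v x| ^ q) (closure Ω) :=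
        hvc.abs.rpow_const (fun x _ => Or.inr hq0.le)
      exact (this.integrableOn_compact hΩb.isCompact_closure).mono_set subset_closure
    have hκ0 : κ 0 = K := by simp [hκ]; ring
    simp only [hz, hκ0]
    have hKq : 0 < K ^ q := Real.rpow_pos_of_pos hK q
    have h1 : K ^ q * volume.real {x | x ∈ Ω ∧ K < v x} ≤ ∫ x in Ω, |v x| ^ q := by
      calc K ^ q * volume.real {x | x ∈ Ω ∧ K < v x}
          = ∫ x in {x | x ∈ Ω ∧ K < v x}, K ^ q := by simp [mul_comm]
        _ ≤ ∫ x in {x | x ∈ Ω ∧ K < v x}, |v x| ^ q := by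
            refine setIntegral_mono_on (integrableOn_const (hfin K))
              (hvi.mono_set fun x hx => hx.1) (hopen K).measurableSet ?_
            intro x hx
            exact Real.rpow_le_rpow hK.le (hx.2.le.trans (le_abs_self _)) hq0.le
        _ ≤ _ := setIntegral_mono_set hvi
            (ae_of_all _ fun x => Real.rpow_nonneg (abs_nonneg _) _)
            (LE.le.eventuallyLE fun x hx => hx.1)
    have h2 := Real.rpow_le_rpow (by positivity) h1 (z := 1 / q) (by positivity)
    rw [Real.mul_rpow hKq.le measureReal_nonneg, ← Real.rpow_mul hK.le,
      mul_one_div_cancel hq0.ne', Real.rpow_one] at h2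
    exact h2
  set B := 8 * 2 ^ (p - 1) * (S * (ε * 2 ^ (p - 1)) * A) with hB
  have hrec : ∀ j, z (j + 1) ≤ B * 2 ^ j * z j ^ (p - 1) := by
    intro j
    have hj : (0:ℝ) < (1/2) ^ j := by positivity
    have hj1 : ((1:ℝ)/2) ^ j ≤ 1 := pow_le_one₀ (by norm_num) (by norm_num)
    have hstep := level_step hΩo hΩb hvc hv2 hv0 hrρ hp hq ha hS hSob (K := K) (k := κ j)
      (h := κ (j + 1)) (ε := ε) (C₀ := C₀) hK (by simp only [hκ]; nlinarith)
      (by simp only [hκ, pow_succ]; nlinarith) (by simp only [hκ, pow_succ]; nlinarith)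
      hε hlap hW hsm
    set mj := volume.real {x | x ∈ Ω ∧ κ j < v x} with hmj
    set mj1 := volume.real {x | x ∈ Ω ∧ κ (j + 1) < v x} with hmj1
    have hm0 : 0 ≤ mj := measureReal_nonneg
    have e1 : (κ (j + 1) - κ j) / 2 * mj1 ^ (1 / q) = (1/2) ^ j / 4 * z (j + 1) := by
      have ek : κ (j + 1) - κ j = K * ((1/2) ^ j / 2) := by simp only [hκ, pow_succ]; ring
      have ez : z (j + 1) = K * mj1 ^ (1 / q) := rfl
      rw [ek, ez]; ring
    have e2 : (2 * K) ^ (p - 1) * mj ^ ((p - 1) / q) = 2 ^ (p - 1) * z j ^ (p - 1) := by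
      simp only [hz]
      rw [Real.mul_rpow (by norm_num) hK.le, Real.mul_rpow hK.le (Real.rpow_nonneg hm0 _),
        ← Real.rpow_mul hm0]
      have : 1 / q * (p - 1) = (p - 1) / q := by ring
      rw [this]; ring
    rw [e1, ← hA, mul_assoc (S * (ε * 2 ^ (p - 1)) * A), e2] at hstep
    have e3 : (2:ℝ) ^ j * (1/2) ^ j = 1 := by rw [← mul_pow]; norm_num
    have h2j : (0:ℝ) < 4 * 2 ^ j := by positivity
    have := mul_le_mul_of_nonneg_left hstep h2j.le
    calc z (j + 1) = ((2:ℝ) ^ j * (1/2) ^ j) * z (j + 1) := by rw [e3, one_mul]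
      _ = 4 * 2 ^ j * ((1/2) ^ j / 4 * z (j + 1)) := by ring
      _ ≤ _ := this
      _ = _ := by rw [hB]; ring
  have hdec := iteration_decay hp hC₀ (by positivity) hz0 hstart hrec hθ hθp
    (by rw [hB]; linarith)
  set m := volume.real {x | x ∈ Ω ∧ 2 * K < v x} with hm
  have hmz : ∀ j, K * m ^ (1 / q) ≤ C₀ * θ ^ j := by
    intro j
    refine le_trans ?_ (hdec j)
    refine mul_le_mul_of_nonneg_left ?_ hK.le
    refine Real.rpow_le_rpow measureReal_nonneg ?_ (by positivity)
    refine measureReal_mono ?_ (hfin _)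
    intro x hx
    refine ⟨hx.1, lt_of_le_of_lt ?_ hx.2⟩
    have hj : (0:ℝ) < (1/2) ^ j := by positivity
    simp only [hκ]; nlinarith
  have hlim : Tendsto (fun j : ℕ => C₀ * θ ^ j) atTop (nhds 0) := by
    simpa using (tendsto_pow_atTop_nhds_zero_of_lt_one hθ.le hθ1).const_mul C₀
  have hle : K * m ^ (1 / q) ≤ 0 := ge_of_tendsto' hlim hmz
  have hm0 : m = 0 := by
    by_contra hne
    have : 0 < m := lt_of_le_of_ne measureReal_nonneg (Ne.symm hne)
    have : 0 < K * m ^ (1 / q) := by positivity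
    linarith
  have hempty : {x | x ∈ Ω ∧ 2 * K < v x} = ∅ := by
    rw [← (hopen (2 * K)).measure_eq_zero_iff volume]
    exact (measureReal_eq_zero_iff (hfin _)).mp hm0
  intro x hx
  by_cases hxΩ : x ∈ Ω
  · by_contra hc
    have : x ∈ {x | x ∈ Ω ∧ 2 * K < v x} := ⟨hxΩ, not_le.mp hc⟩
    rw [hempty] at this
    exact this
  · have : x ∈ frontier Ω := by rw [hΩo.frontier_eq]; exact ⟨hx, hxΩ⟩
    rw [hv0 x this]; positivity

lemma lap_neg {N : ℕ} (u : EuclideanSpace ℝ (Fin N) → ℝ) (x : EuclideanSpace ℝ (Fin N)) :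
    lap (fun y => -u y) x = - lap u x := by
  have h : (fun y => -u y) = -u := rfl
  simp only [lap, h, iteratedFDeriv_neg_apply]
  simp

/-- Corollary 2.4 of the paper: under (H0)' and (H1), solutions uniformly
bounded in the `L^{2*}(Ω)`-norm are uniformly bounded in the `L^∞(Ω)`-norm. -/
theorem statement1 (N : ℕ) (hN : 2 < N)
    (Ω : Set (EuclideanSpace ℝ (Fin N))) (hΩo : IsOpen Ω)
    (hΩb : Bornology.IsBounded Ω) (hΩc : IsConnected Ω)
    (r : ℝ) (hr : (N : ℝ) / 2 < r)
    -- the weight `a ∈ L^r(Ω)`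
    (a : EuclideanSpace ℝ (Fin N) → ℝ)
    (ha_meas : AEMeasurable a (volume.restrict Ω))
    (ha_Lr : IntegrableOn (fun x => |a x| ^ r) Ω)
    -- `f̃` continuous, nonnegative, positive for `|s| > s₀`, subcritical
    (ftil : ℝ → ℝ) (hftil_cont : Continuous ftil) (hftil_nonneg : ∀ s, 0 ≤ ftil s)
    (s₀ : ℝ) (hs₀ : 0 ≤ s₀) (hftil_pos : ∀ s : ℝ, s₀ < |s| → 0 < ftil s)
    (hsub : Tendsto (fun s : ℝ => ftil s / |s| ^ (twoStarSub N r - 1))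
      (cocompact ℝ) (nhds 0))
    -- `f` Carathéodory, with growth (H0)'
    (f : EuclideanSpace ℝ (Fin N) → ℝ → ℝ)
    (hf_meas : ∀ s : ℝ, AEMeasurable (fun x => f x s) (volume.restrict Ω))
    (hf_cont : ∀ᵐ x ∂(volume.restrict Ω), Continuous fun s => f x s)
    (hf_growth : ∀ x ∈ closure Ω, ∀ s : ℝ, |f x s| ≤ |a x| * ftil s)
    -- hypothesis (H1)
    (c₀ : ℝ) (hc₀ : 0 < c₀)
    (hH1 : limsup (fun s : ℝ =>
      sSup (ftil '' Icc (-s) s) / max (ftil (-s)) (ftil s)) atTop ≤ c₀)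
    (C₀ : ℝ) (hC₀ : 0 < C₀) :
    ∃ C > 0, ∀ u : EuclideanSpace ℝ (Fin N) → ℝ, IsClassicalSolution Ω f u →
      lpNorm Ω (twoStar N) u ≤ C₀ → supNorm Ω u ≤ C := by
  have hN' : (2:ℝ) < N := by exact_mod_cast hN
  have hN2 : (0:ℝ) < (N:ℝ) - 2 := by linarith
  have hr1 : 1 < r := by linarith
  have hr0 : 0 < r := by linarith
  have hrρ : r.HolderConjugate (r / (r - 1)) := Real.HolderConjugate.conjExponent hr1
  set p := twoStarSub N r with hp_def
  have hp : 2 < p := by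
    rw [hp_def, twoStarSub, twoStar]
    have h1 : 1 / r < 2 / N := by
      rw [div_lt_div_iff₀ hr0 (by linarith)]; linarith
    have h2 : 2 * (N:ℝ) / (N - 2) * (1 - 2 / N) = 2 := by
      have : (N:ℝ) ≠ 0 := by linarith
      field_simp
    have h3 : 0 < 2 * (N:ℝ) / (N - 2) := by positivity
    nlinarith
  have hq : twoStar N = p * (r / (r - 1)) := by
    rw [hp_def, twoStarSub]
    have : r - 1 ≠ 0 := by linarith
    field_simp
  have ha : MemLp (fun x => |a x|) (ENNReal.ofReal r) (volume.restrict Ω) := by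
    rw [← integrable_norm_rpow_iff ha_meas.abs.aestronglyMeasurable (by simpa using hr0) (by simp)]
    rw [ENNReal.toReal_ofReal hr0.le]
    simpa [IntegrableOn] using ha_Lr
  obtain ⟨S, hS, hSob⟩ := sobolev_exists hN
  set A := (∫ x in Ω, |a x| ^ r) ^ (1 / r) with hA
  have hA0 : 0 ≤ A :=
    Real.rpow_nonneg (integral_nonneg fun x => Real.rpow_nonneg (abs_nonneg _) _) _
  set θ : ℝ := (1/2) ^ (1 / (p - 2)) with hθdef
  have hp2 : 0 < p - 2 := by linarith
  have hθ : 0 < θ := by positivity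
  have hθ1 : θ < 1 := Real.rpow_lt_one (by norm_num) (by norm_num) (by positivity)
  have hθp : 2 * θ ^ (p - 2) = 1 := by
    rw [hθdef, ← Real.rpow_mul (by norm_num), one_div_mul_cancel hp2.ne', Real.rpow_one]
    norm_num
  set D := S * 2 ^ (p - 1) * (A + 1) * C₀ ^ (p - 2) * (8 * 2 ^ (p - 1)) with hD
  have hD0 : 0 < D := by positivity
  set ε := θ / D with hεdef
  have hε : 0 < ε := by positivity
  have hsmall : S * (ε * 2 ^ (p - 1)) * A * C₀ ^ (p - 2) * (8 * 2 ^ (p - 1)) ≤ θ := by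
    have e : ε * D = θ := by rw [hεdef]; field_simp
    have : 0 ≤ S * (ε * 2 ^ (p - 1)) * 1 * C₀ ^ (p - 2) * (8 * 2 ^ (p - 1)) := by positivity
    calc _ ≤ S * (ε * 2 ^ (p - 1)) * A * C₀ ^ (p - 2) * (8 * 2 ^ (p - 1)) +
          S * (ε * 2 ^ (p - 1)) * 1 * C₀ ^ (p - 2) * (8 * 2 ^ (p - 1)) := by linarith
      _ = ε * D := by rw [hD]; ring
      _ = θ := e
  have hev := hsub.eventually (gt_mem_nhds hε)
  rw [cocompact_eq_atBot_atTop, eventually_sup] at hev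
  obtain ⟨K₁, hK₁⟩ := eventually_atBot.mp hev.1
  obtain ⟨K₂, hK₂⟩ := eventually_atTop.mp hev.2
  set K := max 1 (max (-K₁) K₂) with hKdef
  have hK1 : 1 ≤ K := le_max_left _ _
  have hKa : -K₁ ≤ K := (le_max_left _ _).trans (le_max_right _ _)
  have hKb : K₂ ≤ K := (le_max_right _ _).trans (le_max_right _ _)
  have hK : 0 < K := by linarith
  have hft : ∀ s, K ≤ |s| → ftil s ≤ ε * |s| ^ (p - 1) := by
    intro s hs
    have hspos : 0 < |s| := by linarith
    have hlt : ftil s / |s| ^ (p - 1) < ε := by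
      rcases le_abs.mp hs with h | h
      · exact hK₂ s (by linarith)
      · exact hK₁ s (by linarith)
    exact ((div_lt_iff₀ (Real.rpow_pos_of_pos hspos _)).mp hlt).le
  refine ⟨2 * K, by linarith, ?_⟩
  rintro u ⟨huc, hu2, hueq, hu0⟩ huL
  have hlap : ∀ x ∈ Ω, K ≤ |u x| → |lap u x| ≤ ε * (|a x| * |u x| ^ (p - 1)) := by
    intro x hx hux
    have h1 : |lap u x| = |f x (u x)| := by rw [← hueq x hx, abs_neg]
    rw [h1]
    refine (hf_growth x (subset_closure hx) (u x)).trans ?_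
    have := mul_le_mul_of_nonneg_left (hft (u x) hux) (abs_nonneg (a x))
    linarith
  have hup := one_sided hΩo hΩb huc hu2 hu0 hrρ hp hq ha hS hSob hK hε hC₀
    (fun x hx hKx => by
      have hpos : 0 ≤ u x := hK.le.trans hKx
      have := hlap x hx (hKx.trans (le_abs_self _))
      rwa [abs_of_nonneg hpos] at this) huL hθ hθ1 hθp hsmall
  have hdown := one_sided (v := fun y => -u y) hΩo hΩb huc.neg hu2.neg
    (fun x hx => by simp [hu0 x hx]) hrρ hp hq ha hS hSob hK hε hC₀
    (fun x hx hKx => by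
      have hpos : 0 ≤ -u x := hK.le.trans hKx
      have := hlap x hx (hKx.trans (neg_le_abs _))
      rw [lap_neg, abs_neg]
      rwa [← abs_neg (u x), abs_of_nonneg hpos] at this)
    (by simpa only [abs_neg] using (show (∫ x in Ω, |u x| ^ twoStar N) ^ (1 / twoStar N) ≤ C₀ from huL)) hθ hθ1 hθp hsmall
  have hne : ((fun x => |u x|) '' closure Ω).Nonempty := (hΩc.nonempty.mono subset_closure).image _
  refine csSup_le hne ?_
  rintro _ ⟨x, hx, rfl⟩
  exact abs_le.mpr ⟨by linarith [hdown x hx], hup x hx⟩
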